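/- In $U_q(gl(m|n))$, let $a < b$ and $c < d$ be indices in $\mathbf{I}$ with $a, b, c, d$ pairwise distinct, and set $S(a,b) = \{a, a+1, \dots, b\}$ and $S(c,d) = \{c, c+1, \dots, d\}$. If $S(a,b) \cap S(c,d)$ equals $\emptyset$, $S(a,b)$, or $S(c,d)$ (i.e. the two index intervals are disjoint or one contains the other), then all four graded brackets vanish: $[E_{a\,b}, E_{c\,d}\} = [E_{a\,b}, E_{d\,c}\} = [E_{b\,a}, E_{c\,d}\} = [E_{b\,a}, E_{d\,c}\} = 0$, where the brackets are taken with respect to the parities $[a]+[b]$ and $[c]+[d]$ (mod 2). -/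

import Mathlib

open scoped BigOperators

/-- Parity `[a]` of the (1-based) index `a`: `0` for `a ≤ m`, `1` for `a > m`. -/
def par (m a : ℕ) : ℕ := if a ≤ m then 0 else 1

/-- `q_a = q^{(-1)^{[a]}}`: equals `q` for `a ≤ m` and `q⁻¹` for `a > m`. -/
def qpar {F : Type*} [Field F] (q : F) (m a : ℕ) : F := if a ≤ m then q else q⁻¹

/-- `Eup q m e a k = E_{a, a+k+1}`, built recursively from the simple raising generators
`e b = E_{b, b+1}` via `E_{a b} = E_{a c} E_{c b} - q_c⁻¹ E_{c b} E_{a c}` with `c = b - 1`. -/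
def Eup {F : Type*} [Field F] {A : Type*} [Ring A] [Algebra F A]
    (q : F) (m : ℕ) (e : ℕ → A) (a : ℕ) : ℕ → A
  | 0 => e a
  | k + 1 =>
      Eup q m e a k * e (a + k + 1) - (qpar q m (a + k + 1))⁻¹ • (e (a + k + 1) * Eup q m e a k)

/-- `Edown q m f a k = E_{a+k+1, a}`, built recursively from the simple lowering generators
`f b = E_{b+1, b}` via `E_{b a} = E_{b c} E_{c a} - q_c E_{c a} E_{b c}` with `c = b - 1`. -/
def Edown {F : Type*} [Field F] {A : Type*} [Ring A] [Algebra F A]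
    (q : F) (m : ℕ) (f : ℕ → A) (a : ℕ) : ℕ → A
  | 0 => f a
  | k + 1 =>
      f (a + k + 1) * Edown q m f a k - qpar q m (a + k + 1) • (Edown q m f a k * f (a + k + 1))

/-- The root vectors `E_{a b}` of `U_q(gl(m|n))` (and `0` for `a = b`, a value never used). -/
def EE {F : Type*} [Field F] {A : Type*} [Ring A] [Algebra F A]
    (q : F) (m : ℕ) (e f : ℕ → A) (a b : ℕ) : A :=
  if a < b then Eup q m e a (b - a - 1) else if b < a then Edown q m f b (a - b - 1) else 0

/-- A realization of the defining presentation of the quantum supergroup `U_q(gl(m|n))` in a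
unital associative `F`-algebra `A`: elements `K a`, `Kinv a` (`a ∈ I = {1,…,m+n}`) and
`e b = E_{b,b+1}`, `f b = E_{b+1,b}` (`b ∈ I' = {1,…,m+n-1}`) subject to the defining
relations of `U_q(gl(m|n))`. -/
structure UqGl (F : Type*) [Field F] (A : Type*) [Ring A] [Algebra F A]
    (m n : ℕ) (q : F) where
  K : ℕ → A
  Kinv : ℕ → A
  e : ℕ → A
  f : ℕ → A
  K_Kinv : ∀ a, 1 ≤ a → a ≤ m + n → K a * Kinv a = 1
  Kinv_K : ∀ a, 1 ≤ a → a ≤ m + n → Kinv a * K a = 1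
  K_comm : ∀ a b, 1 ≤ a → a ≤ m + n → 1 ≤ b → b ≤ m + n → K a * K b = K b * K a
  K_e : ∀ a b, 1 ≤ a → a ≤ m + n → 1 ≤ b → b + 1 ≤ m + n →
    K a * e b * Kinv a
      = (if a = b then qpar q m a else if a = b + 1 then (qpar q m a)⁻¹ else 1) • e b
  K_f : ∀ a b, 1 ≤ a → a ≤ m + n → 1 ≤ b → b + 1 ≤ m + n →
    K a * f b * Kinv a
      = (if a = b + 1 then qpar q m a else if a = b then (qpar q m a)⁻¹ else 1) • f b
  e_f : ∀ a b, 1 ≤ a → a + 1 ≤ m + n → 1 ≤ b → b + 1 ≤ m + n →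
    e a * f b - (if a = m ∧ b = m then (-1 : F) else 1) • (f b * e a)
      = if a = b
          then (qpar q m a - (qpar q m a)⁻¹)⁻¹ • (K a * Kinv (a + 1) - Kinv a * K (a + 1))
          else 0
  e_m_sq : e m ^ 2 = 0
  f_m_sq : f m ^ 2 = 0
  e_e : ∀ a b, 1 ≤ a → a + 1 ≤ m + n → 1 ≤ b → b + 1 ≤ m + n →
    (a + 2 ≤ b ∨ b + 2 ≤ a) → e a * e b = e b * e a
  f_f : ∀ a b, 1 ≤ a → a + 1 ≤ m + n → 1 ≤ b → b + 1 ≤ m + n →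
    (a + 2 ≤ b ∨ b + 2 ≤ a) → f a * f b = f b * f a
  serre_e : ∀ a b, 1 ≤ a → a + 1 ≤ m + n → 1 ≤ b → b + 1 ≤ m + n → a ≠ m →
    (b = a + 1 ∨ a = b + 1) →
    e a ^ 2 * e b - (q + q⁻¹) • (e a * e b * e a) + e b * e a ^ 2 = 0
  serre_f : ∀ a b, 1 ≤ a → a + 1 ≤ m + n → 1 ≤ b → b + 1 ≤ m + n → a ≠ m →
    (b = a + 1 ∨ a = b + 1) →
    f a ^ 2 * f b - (q + q⁻¹) • (f a * f b * f a) + f b * f a ^ 2 = 0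
  serre_extra_e : 2 ≤ m → 2 ≤ n →
    EE q m e f (m - 1) (m + 2) * e m + e m * EE q m e f (m - 1) (m + 2) = 0
  serre_extra_f : 2 ≤ m → 2 ≤ n →
    EE q m e f (m + 2) (m - 1) * f m + f m * EE q m e f (m + 2) (m - 1) = 0

/-- `X` and `Y` commute up to the scalar `s`. -/
def SC {F : Type*} [Field F] {A : Type*} [Ring A] [Algebra F A] (s : F) (X Y : A) : Prop :=
  X * Y = s • (Y * X)

section aux
variable {F : Type*} [Field F] {A : Type*} [Ring A] [Algebra F A]

theorem SC.left {s t p : F} {X Y g : A} (h1 : SC s X g) (h2 : SC t Y g) :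
    SC (s * t) (X * Y - p • (Y * X)) g := by
  unfold SC at *
  have e1 : X * (Y * g) = (s * t) • (g * (X * Y)) := by
    rw [h2, mul_smul_comm, ← mul_assoc, h1, smul_mul_assoc, smul_smul, mul_assoc, mul_comm t]
  have e2 : Y * (X * g) = (s * t) • (g * (Y * X)) := by
    rw [h1, mul_smul_comm, ← mul_assoc, h2, smul_mul_assoc, smul_smul, mul_assoc]
  simp only [sub_mul, mul_sub, smul_mul_assoc, mul_smul_comm, mul_assoc, e1, e2]
  module

theorem SC.right {s t p : F} {X Y g : A} (h1 : SC s g X) (h2 : SC t g Y) :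
    SC (s * t) g (X * Y - p • (Y * X)) := by
  unfold SC at *
  have e1 : g * (X * Y) = (s * t) • (X * (Y * g)) := by
    rw [← mul_assoc, h1, smul_mul_assoc, mul_assoc, h2, mul_smul_comm, smul_smul]
  have e2 : g * (Y * X) = (s * t) • (Y * (X * g)) := by
    rw [← mul_assoc, h2, smul_mul_assoc, mul_assoc, h1, mul_smul_comm, smul_smul, mul_comm t]
  simp only [sub_mul, mul_sub, smul_mul_assoc, mul_smul_comm, mul_assoc, e1, e2]
  module

theorem SC.symm' {s : F} (hs : s * s = 1) {X Y : A} (h : SC s X Y) : SC s Y X := by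
  unfold SC at *
  rw [h, smul_smul, hs, one_smul]

theorem SC_Eup (q : F) (m : ℕ) (e : ℕ → A) (g : A) (s : ℕ → F) (c l : ℕ)
    (h : ∀ i, c ≤ i → i ≤ c + l → SC (s i) g (e i)) :
    SC (∏ i ∈ Finset.range (l + 1), s (c + i)) g (Eup q m e c l) := by
  induction l with
  | zero => simpa [Eup] using h c le_rfl le_rfl
  | succ l ih =>
    rw [Finset.prod_range_succ]
    exact SC.right (ih fun i h1 h2 => h i h1 (by omega)) (h _ (by omega) (by omega))

theorem SC_Edown (q : F) (m : ℕ) (e : ℕ → A) (g : A) (s : ℕ → F) (c l : ℕ)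
    (h : ∀ i, c ≤ i → i ≤ c + l → SC (s i) g (e i)) :
    SC (∏ i ∈ Finset.range (l + 1), s (c + i)) g (Edown q m e c l) := by
  induction l with
  | zero => simpa [Edown] using h c le_rfl le_rfl
  | succ l ih =>
    rw [Finset.prod_range_succ, mul_comm]
    exact SC.right (h _ (by omega) (by omega)) (ih fun i h1 h2 => h i h1 (by omega))

/-- sign attached to the simple root vectors -/
def sgm (F : Type*) [Field F] (m i : ℕ) : F := if i = m then -1 else 1

theorem prod_sgm (m c l : ℕ) : ∏ i ∈ Finset.range (l + 1), sgm F m (c + i)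
    = if c ≤ m ∧ m ≤ c + l then -1 else 1 := by
  induction l with
  | zero =>
    simp only [sgm, zero_add, Finset.range_one, Finset.prod_singleton, add_zero]
    congr 1
    simp only [eq_iff_iff]; omega
  | succ l ih =>
    rw [Finset.prod_range_succ, ih]
    unfold sgm
    split_ifs <;> first | omega | simp

/-- Relations used (in one triangular half). -/
structure QRel (m N : ℕ) (q : F) (e f : ℕ → A) : Prop where
  q0 : q ≠ 0
  q1 : 1 + q ^ 2 ≠ 0
  ee : ∀ a b, 1 ≤ a → a + 1 ≤ N → 1 ≤ b → b + 1 ≤ N →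
    (a + 2 ≤ b ∨ b + 2 ≤ a) → e a * e b = e b * e a
  serre : ∀ a b, 1 ≤ a → a + 1 ≤ N → 1 ≤ b → b + 1 ≤ N → a ≠ m →
    (b = a + 1 ∨ a = b + 1) →
    e a ^ 2 * e b - (q + q⁻¹) • (e a * e b * e a) + e b * e a ^ 2 = 0
  extra : 2 ≤ m → m + 2 ≤ N → Eup q m e (m - 1) 2 * e m + e m * Eup q m e (m - 1) 2 = 0
  ef : ∀ a b, 1 ≤ a → a + 1 ≤ N → 1 ≤ b → b + 1 ≤ N → a ≠ b → e a * f b = f b * e a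
  eff : ∀ i, 1 ≤ i → i + 3 ≤ N → ∃ (c : F) (h k : A),
    e (i + 1) * f (i + 1) - sgm F m (i + 1) • (f (i + 1) * e (i + 1)) = c • (h - k) ∧
    h * e i = (qpar q m (i + 1))⁻¹ • (e i * h) ∧
    h * e (i + 2) = (qpar q m (i + 2))⁻¹ • (e (i + 2) * h) ∧
    k * e i = qpar q m (i + 1) • (e i * k) ∧
    k * e (i + 2) = qpar q m (i + 2) • (e (i + 2) * k)

theorem qpar_ne {q : F} (h : q ≠ 0) (m a : ℕ) : qpar q m a ≠ 0 := by
  unfold qpar; split_ifs <;> simp [h]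

theorem base_even (r : F) (hr : 1 + r ^ 2 ≠ 0) (x y z : A) (hxz : z * x = x * z)
    (hx : r • (y * (y * x)) - (1 + r ^ 2) • (y * (x * y)) + r • (x * (y * y)) = 0)
    (hz : r • (y * (y * z)) - (1 + r ^ 2) • (y * (z * y)) + r • (z * (y * y)) = 0) :
    ((x * y - r • (y * x)) * z - r • (z * (x * y - r • (y * x)))) * y
      = y * ((x * y - r • (y * x)) * z - r • (z * (x * y - r • (y * x)))) := by
  have hxz' : ∀ w, z * (x * w) = x * (z * w) := fun w => by rw [← mul_assoc, hxz, mul_assoc]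
  have a1 := congrArg (· * z) hx
  have a2 := congrArg (x * ·) hz
  have a3 := congrArg (z * ·) hx
  have a4 := congrArg (· * x) hz
  simp only [mul_add, add_mul, mul_sub, sub_mul, smul_mul_assoc, mul_smul_comm, mul_assoc, hxz,
    hxz', mul_zero, zero_mul] at a1 a2 a3 a4
  rw [← sub_eq_zero]
  refine (smul_right_injective A hr) ?_
  simp only [smul_zero]
  simp only [mul_add, add_mul, mul_sub, sub_mul, smul_mul_assoc, mul_smul_comm, mul_assoc, hxz,
    hxz']
  linear_combination (norm := module) (1 + r ^ 2) • (a1 - a2) + r ^ 2 • (a2 - a1 - a3 + a4)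

theorem base_ef (p p' s c : F) (hp : p ≠ 0) (hp' : p' ≠ 0) (x y z g h k : A)
    (hxz : z * x = x * z) (hxg : x * g = g * x) (hzg : z * g = g * z)
    (hy : y * g - s • (g * y) = c • (h - k))
    (h1 : h * x = p⁻¹ • (x * h)) (h2 : h * z = p'⁻¹ • (z * h))
    (k1 : k * x = p • (x * k)) (k2 : k * z = p' • (z * k)) :
    ((x * y - p⁻¹ • (y * x)) * z - p'⁻¹ • (z * (x * y - p⁻¹ • (y * x)))) * g
      = s • (g * ((x * y - p⁻¹ • (y * x)) * z - p'⁻¹ • (z * (x * y - p⁻¹ • (y * x))))) := by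
  have hxz' : ∀ w, z * (x * w) = x * (z * w) := fun w => by rw [← mul_assoc, hxz, mul_assoc]
  have hxg' : ∀ w, x * (g * w) = g * (x * w) := fun w => by rw [← mul_assoc, hxg, mul_assoc]
  have hzg' : ∀ w, z * (g * w) = g * (z * w) := fun w => by rw [← mul_assoc, hzg, mul_assoc]
  have hy0 : y * g = s • (g * y) + c • (h - k) := by rw [← hy]; abel
  have hy' : ∀ w, y * (g * w) = s • (g * (y * w)) + c • (h * w - k * w) := fun w => by
    rw [← mul_assoc, hy0]; simp only [add_mul, sub_mul, smul_mul_assoc, mul_assoc]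
  have h1' : ∀ w, h * (x * w) = p⁻¹ • (x * (h * w)) := fun w => by
    rw [← mul_assoc, h1, smul_mul_assoc, mul_assoc]
  have k1' : ∀ w, k * (x * w) = p • (x * (k * w)) := fun w => by
    rw [← mul_assoc, k1, smul_mul_assoc, mul_assoc]
  simp only [mul_add, add_mul, mul_sub, sub_mul, smul_mul_assoc, mul_smul_comm, mul_assoc, hxz,
    hxz', hxg, hxg', hzg, hzg', hy0, hy', h1, h1', h2, k1, k1', k2, smul_smul, smul_add, smul_sub]
  match_scalars <;> field_simp <;> ring

namespace QRel
variable {m N : ℕ} {q : F} {e f : ℕ → A}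

theorem eup_comm (R : QRel m N q e f) (a k : ℕ) (g : A)
    (h : ∀ i, a ≤ i → i ≤ a + k → SC (1 : F) g (e i)) : SC (1 : F) g (Eup q m e a k) := by
  simpa using SC_Eup q m e g (fun _ => 1) a k h

theorem eup_left (R : QRel m N q e f) (a k : ℕ) (ha : 1 ≤ a) (hN : a + k + 2 ≤ N) :
    Eup q m e a (k + 1) = e a * Eup q m e (a + 1) k
      - (qpar q m (a + 1))⁻¹ • (Eup q m e (a + 1) k * e a) := by
  induction k with
  | zero => simp [Eup]
  | succ k ih =>
    have hc : e (a + (k + 1) + 1) * e a = e a * e (a + (k + 1) + 1) :=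
      R.ee _ _ (by omega) (by omega) (by omega) (by omega) (by omega)
    have hc' : ∀ w, e (a + (k + 1) + 1) * (e a * w) = e a * (e (a + (k + 1) + 1) * w) :=
      fun w => by rw [← mul_assoc, hc, mul_assoc]
    rw [Eup, ih (by omega), Eup, show a + 1 + k + 1 = a + (k + 1) + 1 by ring]
    simp only [mul_sub, sub_mul, smul_mul_assoc, mul_smul_comm, mul_assoc, hc, hc']
    module

/-- Reduction to rank three. -/
theorem nested (R : QRel m N q e f) (g : A) (s : F) (i : ℕ) (hi : 2 ≤ i) (hiN : i + 2 ≤ N)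
    (hg : ∀ j, 1 ≤ j → j + 1 ≤ N → (j + 2 ≤ i ∨ i + 2 ≤ j) → SC (1 : F) (e j) g)
    (hb : SC s (Eup q m e (i - 1) 2) g) (a k : ℕ) (ha : 1 ≤ a) (hai : a < i)
    (hik : i + 1 ≤ a + k) (hN : a + k + 1 ≤ N) : SC s (Eup q m e a k) g := by
  have step1 : ∀ k, i + 1 ≤ i - 1 + k → i - 1 + k + 1 ≤ N → SC s (Eup q m e (i - 1) k) g := by
    intro k hk
    obtain ⟨t, rfl⟩ : ∃ t, k = 2 + t := ⟨k - 2, by omega⟩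
    clear hk
    induction t with
    | zero => intro _; exact hb
    | succ t ih =>
      intro hN
      rw [← add_assoc, Eup, ← mul_one s]
      exact SC.left (ih (by omega)) (hg _ (by omega) (by omega) (by omega))
  obtain ⟨t, ht⟩ : ∃ t, i = a + 1 + t := ⟨i - a - 1, by omega⟩
  induction t generalizing a k with
  | zero =>
    obtain rfl : a = i - 1 := by omega
    exact step1 k (by omega) (by omega)
  | succ t ih =>
    obtain ⟨k, rfl⟩ : ∃ k', k = k' + 1 := ⟨k - 1, by omega⟩
    rw [R.eup_left a k ha (by omega), ← one_mul s]
    exact SC.left (hg _ (by omega) (by omega) (by omega))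
      (ih (a + 1) k (by omega) (by omega) (by omega) (by omega) (by omega))

theorem nested_e (R : QRel m N q e f) (a k i : ℕ) (ha : 1 ≤ a) (hai : a < i)
    (hik : i + 1 ≤ a + k) (hN : a + k + 1 ≤ N) : SC (sgm F m i) (Eup q m e a k) (e i) := by
  refine R.nested _ _ i (by omega) (by omega) (fun j h1 h2 h3 => ?_) ?_ a k ha hai hik hN
  · unfold SC; rw [one_smul]; exact R.ee _ _ h1 h2 (by omega) (by omega) h3
  · by_cases him : i = m
    · subst him
      have := R.extra (by omega) (by omega)
      simp only [SC, sgm, if_true, neg_smul, one_smul]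
      exact eq_neg_of_add_eq_zero_left this
    · simp only [SC, sgm, if_neg him, one_smul]
      obtain ⟨j, rfl⟩ : ∃ j, i = j + 1 := ⟨i - 1, by omega⟩
      have hq : qpar q m (j + 1 + 1) = qpar q m (j + 1) := by
        unfold qpar
        split_ifs <;> first | rfl | omega
      have hp := qpar_ne R.q0 m (j + 1)
      have hqq : q + q⁻¹ = qpar q m (j + 1) + (qpar q m (j + 1))⁻¹ := by
        unfold qpar
        split_ifs
        · rfl
        · rw [inv_inv, add_comm]
      have hs : ∀ b, 1 ≤ b → b + 1 ≤ N → (b = j + 1 + 1 ∨ j + 1 = b + 1) →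
          (qpar q m (j + 1))⁻¹ • (e (j + 1) * (e (j + 1) * e b))
          - (1 + (qpar q m (j + 1))⁻¹ ^ 2) • (e (j + 1) * (e b * e (j + 1)))
          + (qpar q m (j + 1))⁻¹ • (e b * (e (j + 1) * e (j + 1))) = 0 := by
        intro b h1 h2 h3
        have := R.serre (j + 1) b (by omega) (by omega) h1 h2 him h3
        rw [hqq] at this
        have := congrArg ((qpar q m (j + 1))⁻¹ • ·) this
        simp only [pow_two, mul_assoc, smul_zero] at this
        rw [← this]
        match_scalars <;> field_simp
      have h1 : 1 + (qpar q m (j + 1))⁻¹ ^ 2 ≠ 0 := by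
        have h0 := R.q1
        have h00 := R.q0
        unfold qpar
        split_ifs
        · intro h; apply h0; field_simp at h; linear_combination h
        · simpa using h0
      have := base_even _ h1 (e j) (e (j + 1)) (e (j + 1 + 1))
        (R.ee _ _ (by omega) (by omega) (by omega) (by omega) (by omega))
        (hs j (by omega) (by omega) (by omega)) (hs (j + 1 + 1) (by omega) (by omega) (by omega))
      simpa [Eup, hq] using this

theorem nested_f (R : QRel m N q e f) (a k i : ℕ) (ha : 1 ≤ a) (hai : a < i)
    (hik : i + 1 ≤ a + k) (hN : a + k + 1 ≤ N) : SC (sgm F m i) (Eup q m e a k) (f i) := by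
  refine R.nested _ _ i (by omega) (by omega) (fun j h1 h2 h3 => ?_) ?_ a k ha hai hik hN
  · unfold SC; rw [one_smul]; exact R.ef _ _ h1 h2 (by omega) (by omega) (by omega)
  · obtain ⟨j, rfl⟩ : ∃ j, i = j + 1 := ⟨i - 1, by omega⟩
    obtain ⟨c, h, k, h0, h1, h2, h3, h4⟩ := R.eff j (by omega) (by omega)
    have := base_ef _ _ _ _ (qpar_ne R.q0 m (j + 1)) (qpar_ne R.q0 m (j + 2)) (e j) (e (j + 1))
      (e (j + 2)) (f (j + 1)) h k (R.ee _ _ (by omega) (by omega) (by omega) (by omega) (by omega))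
      (R.ef _ _ (by omega) (by omega) (by omega) (by omega) (by omega))
      (R.ef _ _ (by omega) (by omega) (by omega) (by omega) (by omega)) h0 h1 h2 h3 h4
    exact this

end QRel

theorem qpar_inv (q : F) (m a : ℕ) : qpar q⁻¹ m a = (qpar q m a)⁻¹ := by
  unfold qpar; split_ifs <;> rfl

theorem op_Edown (q : F) (m : ℕ) (f : ℕ → A) (a k : ℕ) :
    MulOpposite.op (Edown q m f a k) = Eup q⁻¹ m (fun i => MulOpposite.op (f i)) a k := by
  induction k with
  | zero => rfl
  | succ k ih => rw [Edown, Eup, ← ih, qpar_inv, inv_inv]; rfl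

theorem SC_op {s : F} {X Y : A} (h : SC s (MulOpposite.op X) (MulOpposite.op Y)) : SC s Y X := by
  unfold SC at *
  simpa using congrArg MulOpposite.unop h

/-- conjugation relation to commutation relation -/
theorem conj1 {k k' x : A} {c : F} (h1 : k' * k = 1) (h : k * x * k' = c • x) :
    k * x = c • (x * k) := by
  have := congrArg (· * k) h
  simpa [mul_assoc, h1] using this

theorem conj2 {k k' x : A} {c : F} (hc : c ≠ 0) (h1 : k' * k = 1) (h : k * x * k' = c • x) :
    k' * x = c⁻¹ • (x * k') := by
  have := congrArg (fun w => c⁻¹ • (k' * w)) h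
  simp only [← mul_assoc, h1, one_mul, mul_smul_comm, smul_smul, inv_mul_cancel₀ hc, one_smul]
    at this
  exact this.symm

theorem comb {k l x : A} {c d : F} (h1 : k * x = c • (x * k)) (h2 : l * x = d • (x * l)) :
    (k * l) * x = (c * d) • (x * (k * l)) := by
  rw [mul_assoc, h2, mul_smul_comm, ← mul_assoc, h1, smul_mul_assoc, smul_smul, mul_assoc,
    mul_comm d]

theorem flip' {k x : A} {c : F} (hc : c ≠ 0) (h : k * x = c • (x * k)) :
    x * k = c⁻¹ • (k * x) := by
  rw [h, smul_smul, inv_mul_cancel₀ hc, one_smul]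

variable {m n : ℕ} {q : F}

theorem UqGl.rel (U : UqGl F A m n q) (h0 : q ≠ 0) (h1 : 1 + q ^ 2 ≠ 0) :
    QRel m (m + n) q U.e U.f where
  q0 := h0
  q1 := h1
  ee := U.e_e
  serre := U.serre_e
  extra h2 h3 := by
    have := U.serre_extra_e h2 (by omega)
    rwa [EE, if_pos (by omega), show m + 2 - (m - 1) - 1 = 2 by omega] at this
  ef a b g1 g2 g3 g4 h := by
    have := U.e_f a b g1 g2 g3 g4
    rw [if_neg (by omega), if_neg h, one_smul] at this
    exact sub_eq_zero.mp this
  eff i g1 g2 := by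
    have hne := qpar_ne h0 m
    have hK : ∀ a, 1 ≤ a → a ≤ m + n → _ := U.Kinv_K
    have e1 := U.K_e (i + 1) i (by omega) (by omega) (by omega) (by omega)
    have e2 := U.K_e (i + 2) i (by omega) (by omega) (by omega) (by omega)
    have e3 := U.K_e (i + 1) (i + 2) (by omega) (by omega) (by omega) (by omega)
    have e4 := U.K_e (i + 2) (i + 2) (by omega) (by omega) (by omega) (by omega)
    simp only [show i + 1 ≠ i by omega, show i + 2 ≠ i by omega, show i + 2 ≠ i + 1 by omega,
      show i + 1 ≠ i + 2 by omega, show i + 1 ≠ i + 2 + 1 by omega, if_true, if_false]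
      at e1 e2 e3 e4
    have k1 := hK (i + 1) (by omega) (by omega)
    have k2 := hK (i + 2) (by omega) (by omega)
    refine ⟨(qpar q m (i + 1) - (qpar q m (i + 1))⁻¹)⁻¹, U.K (i + 1) * U.Kinv (i + 2),
      U.Kinv (i + 1) * U.K (i + 2), ?_, ?_, ?_, ?_, ?_⟩
    · have := U.e_f (i + 1) (i + 1) (by omega) (by omega) (by omega) (by omega)
      simpa [sgm] using this
    · simpa using comb (conj1 k1 e1) (conj2 one_ne_zero k2 e2)
    · simpa using comb (conj1 k1 e3) (conj2 (hne _) k2 e4)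
    · simpa using comb (conj2 (inv_ne_zero (hne _)) k1 e1) (conj1 k2 e2)
    · simpa using comb (conj2 one_ne_zero k1 e3) (conj1 k2 e4)

theorem UqGl.relop (U : UqGl F A m n q) (h0 : q ≠ 0) (h1 : 1 + q ^ 2 ≠ 0) :
    QRel m (m + n) q⁻¹ (fun i => MulOpposite.op (U.f i)) (fun i => MulOpposite.op (U.e i)) where
  q0 := inv_ne_zero h0
  q1 := by
    intro h; apply h1; field_simp at h; linear_combination h
  ee a b g1 g2 g3 g4 h := by
    simp only [← MulOpposite.op_mul]
    rw [U.f_f a b g1 g2 g3 g4 h]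
  serre a b g1 g2 g3 g4 g5 h := by
    have := congrArg MulOpposite.op (U.serre_f a b g1 g2 g3 g4 g5 h)
    simp only [MulOpposite.op_add, MulOpposite.op_sub, MulOpposite.op_smul, MulOpposite.op_mul,
      MulOpposite.op_pow, MulOpposite.op_zero, ← mul_assoc] at this
    rw [← this, inv_inv, add_comm q⁻¹ q]
    abel
  extra h2 h3 := by
    have := congrArg MulOpposite.op (U.serre_extra_f h2 (by omega))
    rw [EE, if_neg (by omega), if_pos (by omega), show m + 2 - (m - 1) - 1 = 2 by omega] at this
    rw [← op_Edown]
    simp only [MulOpposite.op_add, MulOpposite.op_mul, MulOpposite.op_zero] at this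
    rw [← this, add_comm]
  ef a b g1 g2 g3 g4 h := by
    have := U.e_f b a g3 g4 g1 g2
    rw [if_neg (by omega), if_neg (by omega), one_smul] at this
    simp only [← MulOpposite.op_mul]
    rw [sub_eq_zero.mp this]
  eff i g1 g2 := by
    have hne := qpar_ne h0 m
    have hK : ∀ a, 1 ≤ a → a ≤ m + n → _ := U.Kinv_K
    have e1 := U.K_f (i + 1) i (by omega) (by omega) (by omega) (by omega)
    have e2 := U.K_f (i + 2) i (by omega) (by omega) (by omega) (by omega)
    have e3 := U.K_f (i + 1) (i + 2) (by omega) (by omega) (by omega) (by omega)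
    have e4 := U.K_f (i + 2) (i + 2) (by omega) (by omega) (by omega) (by omega)
    simp only [show i + 1 ≠ i by omega, show i + 2 ≠ i by omega, show i + 2 ≠ i + 1 by omega,
      show i + 1 ≠ i + 2 by omega, show i + 1 ≠ i + 2 + 1 by omega,
      show i + 2 ≠ i + 2 + 1 by omega, if_true, if_false]
      at e1 e2 e3 e4
    have k1 := hK (i + 1) (by omega) (by omega)
    have k2 := hK (i + 2) (by omega) (by omega)
    refine ⟨-(qpar q m (i + 1) - (qpar q m (i + 1))⁻¹)⁻¹,
      MulOpposite.op (U.Kinv (i + 1) * U.K (i + 2)),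
      MulOpposite.op (U.K (i + 1) * U.Kinv (i + 2)), ?_, ?_, ?_, ?_, ?_⟩
    · have := congrArg MulOpposite.op
        (U.e_f (i + 1) (i + 1) (by omega) (by omega) (by omega) (by omega))
      simp only [and_self, if_true, MulOpposite.op_sub, MulOpposite.op_smul] at this
      simp only [← MulOpposite.op_mul, sgm, neg_smul, ← smul_neg, neg_sub]
      exact this
    all_goals
      simp only [← MulOpposite.op_mul, ← MulOpposite.op_smul, qpar_inv, inv_inv]
      congr 1
    · simpa using flip' (by simp [hne]) (comb (conj2 (hne _) k1 e1) (conj1 k2 e2))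
    · simpa using flip' (by simp [hne]) (comb (conj2 one_ne_zero k1 e3) (conj1 k2 e4))
    · simpa using flip' (by simp [hne]) (comb (conj1 k1 e1) (conj2 one_ne_zero k2 e2))
    · simpa using flip' (by simp [hne])
        (comb (conj1 k1 e3) (conj2 (inv_ne_zero (hne _)) k2 e4))

theorem sgm_sq (m c l : ℕ) : (∏ i ∈ Finset.range (l + 1), sgm F m (c + i))
    * (∏ i ∈ Finset.range (l + 1), sgm F m (c + i)) = 1 := by
  rw [prod_sgm]; split_ifs <;> simp

/-- the nested case -/
theorem UqGl.nested (U : UqGl F A m n q) (h0 : q ≠ 0) (h1 : 1 + q ^ 2 ≠ 0) (a k c l : ℕ)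
    (ha : 1 ≤ a) (hac : a < c) (hcl : c + l + 1 ≤ a + k) (hN : a + k + 1 ≤ m + n) :
    let s : F := ∏ i ∈ Finset.range (l + 1), sgm F m (c + i)
    SC s (Eup q m U.e a k) (Eup q m U.e c l) ∧ SC s (Eup q m U.e a k) (Edown q m U.f c l) ∧
    SC s (Edown q m U.f a k) (Eup q m U.e c l) ∧ SC s (Edown q m U.f a k) (Edown q m U.f c l) := by
  intro s
  have R := U.rel h0 h1
  have R' := U.relop h0 h1
  have hs : ∀ i, sgm F m i * sgm F m i = 1 := fun i => by unfold sgm; split_ifs <;> simp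
  refine ⟨SC_Eup _ _ _ _ _ _ _ fun i hi hi' => R.nested_e a k i ha (by omega) (by omega) hN,
    SC_Edown _ _ _ _ _ _ _ fun i hi hi' => R.nested_f a k i ha (by omega) (by omega) hN,
    SC_Eup _ _ _ _ _ _ _ fun i hi hi' => ?_, SC_Edown _ _ _ _ _ _ _ fun i hi hi' => ?_⟩
  · have := R'.nested_f a k i ha (by omega) (by omega) hN
    rw [← op_Edown] at this
    exact (SC_op this).symm' (hs i)
  · have := R'.nested_e a k i ha (by omega) (by omega) hN
    rw [← op_Edown] at this
    exact (SC_op this).symm' (hs i)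

/-- the disjoint case -/
theorem UqGl.disj (U : UqGl F A m n q) (h0 : q ≠ 0) (h1 : 1 + q ^ 2 ≠ 0) (a k c l : ℕ)
    (ha : 1 ≤ a) (hac : a + k + 2 ≤ c) (hN : c + l + 1 ≤ m + n) :
    SC (1 : F) (Eup q m U.e a k) (Eup q m U.e c l) ∧
    SC (1 : F) (Eup q m U.e a k) (Edown q m U.f c l) ∧
    SC (1 : F) (Edown q m U.f a k) (Eup q m U.e c l) ∧
    SC (1 : F) (Edown q m U.f a k) (Edown q m U.f c l) := by
  have R := U.rel h0 h1
  have sy : ∀ {X Y : A}, SC (1 : F) X Y → SC (1 : F) Y X := fun h => h.symm' (by simp)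
  have cu : ∀ (g : A) (x : ℕ → A) (c l : ℕ), (∀ i, c ≤ i → i ≤ c + l → SC (1 : F) g (x i)) →
      SC (1 : F) g (Eup q m x c l) := fun g x c l h => by
    simpa using SC_Eup q m x g (fun _ => 1) c l h
  have cd : ∀ (g : A) (x : ℕ → A) (c l : ℕ), (∀ i, c ≤ i → i ≤ c + l → SC (1 : F) g (x i)) →
      SC (1 : F) g (Edown q m x c l) := fun g x c l h => by
    simpa using SC_Edown q m x g (fun _ => 1) c l h
  have one : ∀ {X Y : A}, X * Y = Y * X → SC (1 : F) X Y := fun h => by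
    unfold SC; rw [one_smul]; exact h
  refine ⟨cu _ _ _ _ fun i _ _ => sy <| cu _ _ _ _ fun j _ _ => one ?_,
    cd _ _ _ _ fun i _ _ => sy <| cu _ _ _ _ fun j _ _ => one ?_,
    cu _ _ _ _ fun i _ _ => sy <| cd _ _ _ _ fun j _ _ => one ?_,
    cd _ _ _ _ fun i _ _ => sy <| cd _ _ _ _ fun j _ _ => one ?_⟩
  · exact U.e_e _ _ (by omega) (by omega) (by omega) (by omega) (by omega)
  · exact (R.ef _ _ (by omega) (by omega) (by omega) (by omega) (by omega)).symm
  · exact R.ef _ _ (by omega) (by omega) (by omega) (by omega) (by omega)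
  · exact U.f_f _ _ (by omega) (by omega) (by omega) (by omega) (by omega)

end aux

/-- In `U_q(gl(m|n))`, if `a < b`, `c < d`, all four indices pairwise distinct, and the index
intervals `S(a,b) = {a,…,b}` and `S(c,d) = {c,…,d}` are disjoint or one contains the other,
then all four graded brackets vanish:
`[E_{ab}, E_{cd}} = [E_{ab}, E_{dc}} = [E_{ba}, E_{cd}} = [E_{ba}, E_{dc}} = 0`. -/
theorem EE_bracket_nested_or_disjoint {F : Type*} [Field F] {A : Type*} [Ring A] [Algebra F A]
    (m n : ℕ) (hm : 1 ≤ m) (hn : 1 ≤ n) (q : F) (hq0 : q ≠ 0)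
    (hq : ∀ k : ℕ, k ≠ 0 → q ^ k ≠ 1) (U : UqGl F A m n q)
    (a b c d : ℕ) (ha : 1 ≤ a) (hab : a < b) (hb : b ≤ m + n)
    (hc : 1 ≤ c) (hcd : c < d) (hd : d ≤ m + n)
    (hac : a ≠ c) (had : a ≠ d) (hbc : b ≠ c) (hbd : b ≠ d)
    (hS : Finset.Icc a b ∩ Finset.Icc c d = ∅ ∨
          Finset.Icc a b ∩ Finset.Icc c d = Finset.Icc a b ∨
          Finset.Icc a b ∩ Finset.Icc c d = Finset.Icc c d) :
    EE q m U.e U.f a b * EE q m U.e U.f c d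
        - ((-1 : F) ^ ((par m a + par m b) * (par m c + par m d))) •
            (EE q m U.e U.f c d * EE q m U.e U.f a b) = 0 ∧
      EE q m U.e U.f a b * EE q m U.e U.f d c
        - ((-1 : F) ^ ((par m a + par m b) * (par m c + par m d))) •
            (EE q m U.e U.f d c * EE q m U.e U.f a b) = 0 ∧
      EE q m U.e U.f b a * EE q m U.e U.f c d
        - ((-1 : F) ^ ((par m a + par m b) * (par m c + par m d))) •
            (EE q m U.e U.f c d * EE q m U.e U.f b a) = 0 ∧
      EE q m U.e U.f b a * EE q m U.e U.f d c
        - ((-1 : F) ^ ((par m a + par m b) * (par m c + par m d))) •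
            (EE q m U.e U.f d c * EE q m U.e U.f b a) = 0 := by
  have h1 : 1 + q ^ 2 ≠ 0 := by
    intro h
    apply hq 4 (by norm_num)
    linear_combination (q ^ 2 - 1) * h
  obtain ⟨k, rfl⟩ : ∃ k, b = a + k + 1 := ⟨b - a - 1, by omega⟩
  obtain ⟨l, rfl⟩ : ∃ l, d = c + l + 1 := ⟨d - c - 1, by omega⟩
  have E1 : ∀ a k, EE q m U.e U.f a (a + k + 1) = Eup q m U.e a k := fun a k => by
    rw [EE, if_pos (by omega), show a + k + 1 - a - 1 = k by omega]
  have E2 : ∀ a k, EE q m U.e U.f (a + k + 1) a = Edown q m U.f a k := fun a k => by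
    rw [EE, if_neg (by omega), if_pos (by omega), show a + k + 1 - a - 1 = k by omega]
  simp only [E1, E2, sub_eq_zero]
  have key : (a + k + 2 ≤ c ∨ c + l + 2 ≤ a) ∨ (c < a ∧ a + k + 1 ≤ c + l) ∨
      (a < c ∧ c + l + 1 ≤ a + k) := by
    rcases hS with h | h | h
    · left
      by_contra hcon
      have : max a c ∈ Finset.Icc a (a + k + 1) ∩ Finset.Icc c (c + l + 1) := by
        simp only [Finset.mem_inter, Finset.mem_Icc]; omega
      rw [h] at this
      simp at this
    · right; left
      have g := Finset.inter_eq_left.mp h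
      have g1 := g (Finset.left_mem_Icc.mpr (by omega))
      have g2 := g (Finset.right_mem_Icc.mpr (by omega))
      simp only [Finset.mem_Icc] at g1 g2
      omega
    · right; right
      have g := Finset.inter_eq_right.mp h
      have g1 := g (Finset.left_mem_Icc.mpr (by omega))
      have g2 := g (Finset.right_mem_Icc.mpr (by omega))
      simp only [Finset.mem_Icc] at g1 g2
      omega
  rcases key with (h | h) | h | h
  · have hs : (-1 : F) ^ ((par m a + par m (a + k + 1)) * (par m c + par m (c + l + 1))) = 1 := by
      unfold par; split_ifs <;> first | omega | norm_num
    rw [hs]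
    exact U.disj hq0 h1 a k c l ha h hd
  · have hs : (-1 : F) ^ ((par m a + par m (a + k + 1)) * (par m c + par m (c + l + 1))) = 1 := by
      unfold par; split_ifs <;> first | omega | norm_num
    rw [hs]
    obtain ⟨p1, p2, p3, p4⟩ := U.disj hq0 h1 c l a k hc h hb
    exact ⟨p1.symm' (by simp), p3.symm' (by simp), p2.symm' (by simp), p4.symm' (by simp)⟩
  · have hs : (-1 : F) ^ ((par m a + par m (a + k + 1)) * (par m c + par m (c + l + 1)))
        = ∏ i ∈ Finset.range (k + 1), sgm F m (a + i) := by
      rw [prod_sgm]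
      unfold par; split_ifs <;> first | omega | norm_num
    rw [hs]
    obtain ⟨p1, p2, p3, p4⟩ := U.nested hq0 h1 c l a k hc h.1 h.2 hd
    have := sgm_sq (F := F) m a k
    exact ⟨p1.symm' this, p3.symm' this, p2.symm' this, p4.symm' this⟩
  · have hs : (-1 : F) ^ ((par m a + par m (a + k + 1)) * (par m c + par m (c + l + 1)))
        = ∏ i ∈ Finset.range (l + 1), sgm F m (c + i) := by
      rw [prod_sgm]
      unfold par; split_ifs <;> first | omega | norm_num
    rw [hs]
    exact U.nested hq0 h1 a k c l ha h.1 h.2 hb
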